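/- Let 𝔾 be a toroidal grid diagram of grid number n with associated 4-fold toroidal grid diagram 𝔾₄. If x₄ ≠ y₄ are grid states of 𝔾₄ and [r₄] ∈ [Rect](x₄,y₄), then p_{x₄}[r₄] + p_{y₄}[r₄] is a positive odd integer; consequently m[r₄] = (p_{x₄}[r₄] + p_{y₄}[r₄] − 1)/2 is a nonnegative integer. -/

import Mathlib

/-!
Combinatorial model of toroidal grid diagrams, their 4-fold covers, and the
double-point enhanced grid complex (over 𝔽 = ℤ/2ℤ), following Lipshitz and
Ozsváth–Szabó–Sarkar conventions.

* The torus is modelled by `ZMod n × ZMod n`: the horizontal circle `α_j` and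
  vertical circle `β_k` meet at the point `(k, j)`; the square `(k, j)` is the
  one with south-west corner at the point `(k, j)`;  the `O`- and `X`-markings
  of column `k` occupy squares `(k, Orow k)` and `(k, Xrow k)`.
* A grid state is a bijection (column ↦ row), i.e. a permutation of `ZMod n`.
* The 4-fold cover `𝔾₄` lives on `ZMod (2n) × ZMod (2n)`, with the covering
  map `pr` reducing coordinates mod `n`.  A grid state of `𝔾₄` is the preimage
  of a grid state of `𝔾`, so grid states of `𝔾₄` are canonically identified
  with grid states of `𝔾`; similarly the free module `GC` underlying both
  `GC•(𝔾)` and `GC•(𝔾₄)` is the same, and the identification `J₄` is the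
  identity map.
* Rectangles are recorded by their two vertical circles (west/east) and two
  horizontal circles (south/north); "rectangle from x₄ to y₄" is the boundary
  condition `∂(∂_α(r + Nr + Er + NEr)) = y₄ - x₄` (and the `∂_β` analogue),
  expressed via corner-point indicator functions.  Each `N,E`-equivalence class
  of rectangles in `𝔾₄` contains exactly one *normalized* representative
  (west circle and south circle in the first fundamental domain), so sums over
  equivalence classes are sums over normalized representatives.
-/

noncomputable section

open scoped Classical

namespace GridHomology

/-- the ground field `𝔽 = ℤ/2ℤ` -/
abbrev F : Type := ZMod 2

/-- A toroidal grid diagram of grid number `n`. -/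
structure GridDiagram (n : ℕ) where
  Orow : ZMod n → ZMod n
  Xrow : ZMod n → ZMod n
  hO : Function.Bijective Orow
  hX : Function.Bijective Xrow
  hOX : ∀ i, Orow i ≠ Xrow i

/-- A grid state: one point on each horizontal and each vertical circle. -/
abbrev GridState (n : ℕ) := Equiv.Perm (ZMod n)

instance twoMulNeZero (n : ℕ) [NeZero n] : NeZero (2 * n) :=
  ⟨fun h => NeZero.ne n (by omega)⟩

/-- membership in the cyclic (going east/north) interval `[u, v)` -/
def inIco {m : ℕ} (u v k : ZMod m) : Prop := (k - u).val < (v - u).val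

/-- membership in the open cyclic interval `(u, v)` -/
def inIoo {m : ℕ} (u v k : ZMod m) : Prop :=
  0 < (k - u).val ∧ (k - u).val < (v - u).val

instance {m : ℕ} (u v k : ZMod m) : Decidable (inIco u v k) :=
  inferInstanceAs (Decidable (_ < _))

instance {m : ℕ} (u v k : ZMod m) : Decidable (inIoo u v k) :=
  inferInstanceAs (Decidable (_ ∧ _))

/-- Rectangle data on the `m × m` torus: west and east vertical circles,
south and north horizontal circles. -/
structure Rect (m : ℕ) where
  cW : ZMod m
  cE : ZMod m
  rS : ZMod m
  rN : ZMod m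
deriving DecidableEq

instance (m : ℕ) [NeZero m] : Fintype (Rect m) :=
  Fintype.ofEquiv (ZMod m × ZMod m × ZMod m × ZMod m)
    { toFun := fun p => ⟨p.1, p.2.1, p.2.2.1, p.2.2.2⟩
      invFun := fun r => ⟨r.cW, r.cE, r.rS, r.rN⟩
      left_inv := fun _ => rfl
      right_inv := fun _ => rfl }

/-- local multiplicity of a rectangle at a square of the torus -/
def Rect.mult {m : ℕ} (r : Rect m) (sq : ZMod m × ZMod m) : ℕ :=
  if inIco r.cW r.cE sq.1 ∧ inIco r.rS r.rN sq.2 then 1 else 0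

/-- `r` is an (embedded, not necessarily empty) rectangle from `x` to `y` in `𝔾`:
its south-west and north-east corners lie in `x`, its south-east and north-west
corners lie in `y`, and `x`, `y` agree away from the two vertical circles of `r`. -/
def IsRectFrom {m : ℕ} (x y : GridState m) (r : Rect m) : Prop :=
  r.cW ≠ r.cE ∧ r.rS ≠ r.rN ∧
  x r.cW = r.rS ∧ x r.cE = r.rN ∧ y r.cW = r.rN ∧ y r.cE = r.rS ∧
  ∀ k, k ≠ r.cW → k ≠ r.cE → x k = y k

/-- point-measure of a rectangle in `𝔾` at a grid state `w`: the sum over the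
points of `w` of the average of the four adjacent local multiplicities -/
def Rect.pm {m : ℕ} [NeZero m] (w : GridState m) (r : Rect m) : ℚ :=
  (∑ k : ZMod m, ((r.mult (k - 1, w k - 1) + r.mult (k, w k - 1) +
      r.mult (k - 1, w k) + r.mult (k, w k) : ℕ) : ℚ)) / 4

/-- `m(r) = #(Int r ∩ x)` -/
def Rect.intCount {m : ℕ} [NeZero m] (x : GridState m) (r : Rect m) : ℕ :=
  (Finset.univ.filter fun k => inIoo r.cW r.cE k ∧ inIoo r.rS r.rN (x k)).card

/-- `O_i(r)` in `𝔾` -/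
def Ocount {m : ℕ} (G : GridDiagram m) (r : Rect m) (i : ZMod m) : ℕ :=
  r.mult (i, G.Orow i)

/-- `X_i(r)` in `𝔾` -/
def Xcount {m : ℕ} (G : GridDiagram m) (r : Rect m) (i : ZMod m) : ℕ :=
  r.mult (i, G.Xrow i)

/-- `r ∩ 𝕏 = ∅` -/
def XDisjoint {m : ℕ} (G : GridDiagram m) (r : Rect m) : Prop :=
  ∀ i, Xcount G r i = 0

/-! ### The 4-fold cover -/

/-- the covering projection `π₄ : 𝔾₄ → 𝔾` on coordinates -/
def pr {n : ℕ} (a : ZMod (2 * n)) : ZMod n :=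
  ZMod.castHom (dvd_mul_left n 2) (ZMod n) a

/-- indicator function (as a formal sum of points) of the lifted grid state `x₄` -/
def stInd {n : ℕ} (x : GridState n) (p : ZMod (2 * n) × ZMod (2 * n)) : ℤ :=
  if x (pr p.1) = pr p.2 then 1 else 0

/-- `∂(∂_α r)` as a formal sum of points: `SE + NW − SW − NE` -/
def cornerA {m : ℕ} (r : Rect m) (p : ZMod m × ZMod m) : ℤ :=
  (if p = (r.cE, r.rS) then 1 else 0) + (if p = (r.cW, r.rN) then 1 else 0)
    - (if p = (r.cW, r.rS) then 1 else 0) - (if p = (r.cE, r.rN) then 1 else 0)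

/-- `∂(∂_β r)` as a formal sum of points: `NE + SW − SE − NW` -/
def cornerB {m : ℕ} (r : Rect m) (p : ZMod m × ZMod m) : ℤ :=
  (if p = (r.cE, r.rN) then 1 else 0) + (if p = (r.cW, r.rS) then 1 else 0)
    - (if p = (r.cE, r.rS) then 1 else 0) - (if p = (r.cW, r.rN) then 1 else 0)

/-- northward translation `N` by `n` rows -/
def trN {n : ℕ} (r : Rect (2 * n)) : Rect (2 * n) :=
  ⟨r.cW, r.cE, r.rS + (n : ZMod (2 * n)), r.rN + (n : ZMod (2 * n))⟩

/-- eastward translation `E` by `n` columns -/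
def trE {n : ℕ} (r : Rect (2 * n)) : Rect (2 * n) :=
  ⟨r.cW + (n : ZMod (2 * n)), r.cE + (n : ZMod (2 * n)), r.rS, r.rN⟩

/-- `r` is a rectangle from `x₄` to `y₄` in the 4-fold diagram `𝔾₄`:
`∂(∂_α (r + Nr + Er + NEr)) = y₄ − x₄` and `∂(∂_β (r + Nr + Er + NEr)) = x₄ − y₄`. -/
def IsRect4From {n : ℕ} (x y : GridState n) (r : Rect (2 * n)) : Prop :=
  r.cW ≠ r.cE ∧ r.rS ≠ r.rN ∧
  (∀ p, cornerA r p + cornerA (trN r) p + cornerA (trE r) p + cornerA (trN (trE r)) p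
      = stInd y p - stInd x p) ∧
  (∀ p, cornerB r p + cornerB (trN r) p + cornerB (trE r) p + cornerB (trN (trE r)) p
      = stInd x p - stInd y p)

/-- the canonical (normalized) representative of each `{r, Nr, Er, NEr}`
equivalence class: west and south coordinates lie in the first fundamental domain -/
def normal4 {n : ℕ} (r : Rect (2 * n)) : Prop := r.cW.val < n ∧ r.rS.val < n

instance {n : ℕ} (r : Rect (2 * n)) : Decidable (normal4 r) :=
  inferInstanceAs (Decidable (_ ∧ _))

/-- `O_i[r₄]`: total multiplicity of `r₄` at the four lifts of `O_i` -/
def O4count {n : ℕ} [NeZero n] (G : GridDiagram n) (r : Rect (2 * n)) (i : ZMod n) : ℕ :=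
  ∑ p : ZMod (2 * n) × ZMod (2 * n),
    if pr p.1 = i ∧ pr p.2 = G.Orow i then r.mult p else 0

/-- `X_i[r₄]` -/
def X4count {n : ℕ} [NeZero n] (G : GridDiagram n) (r : Rect (2 * n)) (i : ZMod n) : ℕ :=
  ∑ p : ZMod (2 * n) × ZMod (2 * n),
    if pr p.1 = i ∧ pr p.2 = G.Xrow i then r.mult p else 0

/-- `r₄ ∩ π₄⁻¹(𝕏) = ∅` -/
def XDisjoint4 {n : ℕ} [NeZero n] (G : GridDiagram n) (r : Rect (2 * n)) : Prop :=
  ∀ i, X4count G r i = 0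

/-- point-measure of a domain (an integer-valued multiplicity function on the
squares of `𝔾₄`) at the lifted grid state `w₄` -/
def pm4 {n : ℕ} [NeZero n] (w : GridState n) (ψ : ZMod (2 * n) × ZMod (2 * n) → ℤ) : ℚ :=
  (∑ p : ZMod (2 * n) × ZMod (2 * n),
    if w (pr p.1) = pr p.2 then
      ((ψ (p.1 - 1, p.2 - 1) + ψ (p.1, p.2 - 1) + ψ (p.1 - 1, p.2) + ψ p : ℤ) : ℚ)
    else 0) / 4

/-- a rectangle of `𝔾₄` viewed as a domain -/
def Rect.dom4 {n : ℕ} (r : Rect (2 * n)) : ZMod (2 * n) × ZMod (2 * n) → ℤ :=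
  fun p => (r.mult p : ℤ)

/-- point-measure `p_{w₄}[r₄]` of a rectangle of `𝔾₄` -/
def rpm4 {n : ℕ} [NeZero n] (w : GridState n) (r : Rect (2 * n)) : ℚ :=
  pm4 w r.dom4

/-- `m[r₄] = (p_{x₄}[r₄] + p_{y₄}[r₄] − 1)/2`, as a rational number -/
def mQ4 {n : ℕ} [NeZero n] (x y : GridState n) (r : Rect (2 * n)) : ℚ :=
  (rpm4 x r + rpm4 y r - 1) / 2

/-- `m[r₄]` as a natural number (the exponent of `v`) -/
def m4 {n : ℕ} [NeZero n] (x y : GridState n) (r : Rect (2 * n)) : ℕ :=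
  (⌊mQ4 x y r⌋).toNat

/-! ### Maslov and Alexander gradings (via the planar counting function `J`) -/

/-- the points of a planar fundamental domain associated to `f`, in doubled
coordinates (grid states at even positions, markings at odd positions) -/
def ptsOf {m : ℕ} [NeZero m] (f : ZMod m → ZMod m) (off : ℕ) : Finset (ℕ × ℕ) :=
  Finset.univ.image fun k => (2 * k.val + off, 2 * (f k).val + off)

/-- `I(P,Q)`: pairs `(p,q)` with `q` strictly above and strictly to the right of `p` -/
def Icnt (P Q : Finset (ℕ × ℕ)) : ℕ :=
  ∑ p ∈ P, (Q.filter fun q => p.1 < q.1 ∧ p.2 < q.2).card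

/-- `J(P,Q) = (I(P,Q) + I(Q,P))/2` -/
def Jq (P Q : Finset (ℕ × ℕ)) : ℚ := ((Icnt P Q : ℚ) + (Icnt Q P : ℚ)) / 2

/-- the Maslov-type grading `J(x,x) − 2 J(x,P) + J(P,P) + 1` for markings `P` -/
def MaslovOf {m : ℕ} [NeZero m] (f : ZMod m → ZMod m) (x : GridState m) : ℚ :=
  Jq (ptsOf (⇑x) 0) (ptsOf (⇑x) 0) - 2 * Jq (ptsOf (⇑x) 0) (ptsOf f 1)
    + Jq (ptsOf f 1) (ptsOf f 1) + 1

/-- the Maslov grading `M(x) = M_𝕆(x)` -/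
def MaslovO {m : ℕ} [NeZero m] (G : GridDiagram m) (x : GridState m) : ℚ :=
  MaslovOf G.Orow x

/-- `M_𝕏(x)` -/
def MaslovX {m : ℕ} [NeZero m] (G : GridDiagram m) (x : GridState m) : ℚ :=
  MaslovOf G.Xrow x

/-- the Alexander grading `A(x) = (M_𝕆(x) − M_𝕏(x) − (n−1))/2` -/
def Alex {m : ℕ} [NeZero m] (G : GridDiagram m) (x : GridState m) : ℚ :=
  (MaslovO G x - MaslovX G x - ((m : ℚ) - 1)) / 2

/-! ### The double-point enhanced grid complex -/

/-- the ring `𝔽[V₁, …, V_n, v]`: `V_i = X (some i)`, `v = X none` -/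
abbrev Rng (n : ℕ) : Type := MvPolynomial (Option (ZMod n)) F

/-- the free `𝔽[V₁,…,V_n,v]`-module on the set of grid states; it underlies both
`GC•(𝔾)` and `GC•(𝔾₄)` (their grid states being canonically identified) -/
abbrev GC (n : ℕ) := GridState n →₀ Rng n

/-- the variable `V_i` -/
def Vv {n : ℕ} (i : ZMod n) : Rng n := MvPolynomial.X (some i)

/-- the double-point variable `v` -/
def vV {n : ℕ} : Rng n := MvPolynomial.X none

/-- the `𝔽[V₁,…,V_n,v]`-linear map determined by values on grid states -/
def basisMap {n : ℕ} (f : GridState n → GC n) : GC n →ₗ[Rng n] GC n :=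
  Finsupp.lsum (Rng n) fun x => LinearMap.toSpanSingleton (Rng n) (GC n) (f x)

/-- the weight `V₁^{O₁[r₄]} ⋯ V_n^{O_n[r₄]} v^{m[r₄]}` of a rectangle of `𝔾₄` -/
def wt4 {n : ℕ} [NeZero n] (G : GridDiagram n) (x y : GridState n) (r : Rect (2 * n)) :
    Rng n :=
  (∏ i : ZMod n, Vv i ^ O4count G r i) * vV ^ m4 x y r

/-- the differential `∂₄•` of `GC•(𝔾₄)`: counts `N,E`-equivalence classes of
rectangles (via their normalized representatives) disjoint from `π₄⁻¹(𝕏)` -/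
def diff4 {n : ℕ} [NeZero n] (G : GridDiagram n) : GC n →ₗ[Rng n] GC n :=
  basisMap fun x => ∑ y : GridState n,
    ∑ r ∈ Finset.univ.filter
        (fun r : Rect (2 * n) => IsRect4From x y r ∧ normal4 r ∧ XDisjoint4 G r),
      Finsupp.single y (wt4 G x y r)

/-- the weight of a rectangle of `𝔾` -/
def wtB {n : ℕ} [NeZero n] (G : GridDiagram n) (x : GridState n) (r : Rect n) : Rng n :=
  (∏ i : ZMod n, Vv i ^ Ocount G r i) * vV ^ Rect.intCount x r

/-- the differential `∂•` of the double-point enhanced grid complex `GC•(𝔾)` -/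
def diffB {n : ℕ} [NeZero n] (G : GridDiagram n) : GC n →ₗ[Rng n] GC n :=
  basisMap fun x => ∑ y : GridState n,
    ∑ r ∈ Finset.univ.filter
        (fun r : Rect n => IsRectFrom x y r ∧ XDisjoint G r),
      Finsupp.single y (wtB G x r)

/-- `z` is homogeneous of bidegree `(d, s)` for the (Maslov, Alexander) bigrading
extended by `M(V₁^{k₁}⋯V_n^{k_n} v^m ⋅ x) = M(x) − 2Σkᵢ + 2m`,
`A(V₁^{k₁}⋯V_n^{k_n} v^m ⋅ x) = A(x) − Σkᵢ`. -/
def IsHomog {n : ℕ} [NeZero n] (G : GridDiagram n) (z : GC n) (d s : ℚ) : Prop :=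
  ∀ (y : GridState n) (k : Option (ZMod n) →₀ ℕ), MvPolynomial.coeff k (z y) ≠ 0 →
    (MaslovO G y - 2 * ∑ i : ZMod n, (k (some i) : ℚ) + 2 * (k none : ℚ) = d) ∧
    (Alex G y - ∑ i : ZMod n, (k (some i) : ℚ) = s)

/-- a linear map is homogeneous of degree `(a, b)` -/
def MapHomog {n : ℕ} [NeZero n] (G G' : GridDiagram n) (φ : GC n →ₗ[Rng n] GC n)
    (a b : ℚ) : Prop :=
  ∀ z d s, IsHomog G z d s → IsHomog G' (φ z) (d + a) (s + b)

/-- `𝔾` represents a knot: following the link (column `i` joins its `O` to the `X`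
in the same row, etc.) visits every column -/
def IsKnot {n : ℕ} (G : GridDiagram n) : Prop :=
  ∀ i j : ZMod n, ∃ k : ℕ,
    (((Equiv.ofBijective G.Orow G.hO).trans (Equiv.ofBijective G.Xrow G.hX).symm) ^ k) i = j

/-- the homotopy operator `𝓗_{X_j}•` counting equivalence classes of rectangles in
`𝔾₄` crossing the lifts of `X_j` exactly once and no other `X`-marking -/
def HXmap {n : ℕ} [NeZero n] (G : GridDiagram n) (j : ZMod n) : GC n →ₗ[Rng n] GC n :=
  basisMap fun x => ∑ y : GridState n,
    ∑ r ∈ Finset.univ.filter (fun r : Rect (2 * n) =>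
        IsRect4From x y r ∧ normal4 r ∧ X4count G r j = 1 ∧
        ∀ k, k ≠ j → X4count G r k = 0),
      Finsupp.single y (wt4 G x y r)

/-! ### Commutation moves, pentagons and hexagons

`𝔾` and `𝔾'` differ by commuting the (adjacent) columns `c−1` and `c`; they are
drawn on a common torus, sharing all markings and all circles except that the
vertical circle `β_c` of `𝔾` is replaced in `𝔾'` by a curve `γ_c` which passes
to the west of the marking line within the rows of the cyclic interval
`J = [h₁, h₂)` (which contains the markings of column `c−1`) and to the east of
it in the complementary rows (which contain the markings of column `c`);
`γ_c` crosses `β_c` at two points `a` (just south of the row-circle `h₂`) and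
`b` (just south of `h₁`).  Grid states of `𝔾'` are again recorded as
permutations (the `γ`-point in row `j` replacing the `β_c`-point). -/

structure CommData (n : ℕ) where
  G : GridDiagram n
  G' : GridDiagram n
  c : ZMod n
  h₁ : ZMod n
  h₂ : ZMod n
  hne : h₁ ≠ h₂
  hOA : inIco h₁ h₂ (G.Orow (c - 1))
  hXA : inIco h₁ h₂ (G.Xrow (c - 1))
  hOB : ¬ inIco h₁ h₂ (G.Orow c)
  hXB : ¬ inIco h₁ h₂ (G.Xrow c)
  hO'A : G'.Orow (c - 1) = G.Orow c
  hO'B : G'.Orow c = G.Orow (c - 1)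
  hX'A : G'.Xrow (c - 1) = G.Xrow c
  hX'B : G'.Xrow c = G.Xrow (c - 1)
  hO' : ∀ k, k ≠ c - 1 → k ≠ c → G'.Orow k = G.Orow k
  hX' : ∀ k, k ≠ c - 1 → k ≠ c → G'.Xrow k = G.Xrow k

/-- Pentagon data in the 4-fold torus `T₄`: the underlying rectangle
`I₄(p)` of `𝔾₄`, the side of the curved edge (`left = true` means the curved
vertical edge is the east edge of the rectangle), and the lifted height `hh`
of the crossing point (`a` or `b`) serving as the fifth corner. -/
structure Pent (n : ℕ) where
  rect : Rect (2 * n)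
  left : Bool
  hh : ZMod (2 * n)
deriving DecidableEq

instance (n : ℕ) [NeZero n] : Fintype (Pent n) :=
  Fintype.ofEquiv (Rect (2 * n) × Bool × ZMod (2 * n))
    { toFun := fun p => ⟨p.1, p.2.1, p.2.2⟩
      invFun := fun p => ⟨p.rect, p.left, p.hh⟩
      left_inv := fun _ => rfl
      right_inv := fun _ => rfl }

/-- the distinguished vertical edge lies on a lift of the curved circle -/
def onCedge {n : ℕ} (C : CommData n) (p : Pent n) : Prop :=
  if p.left then pr p.rect.cE = C.c else pr p.rect.cW = C.c

/-- the crossing point (at height just below the row circle `h`) lies strictly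
inside the vertical extent of the rectangle -/
def heightOK {n : ℕ} (r : Rect (2 * n)) (h : ZMod (2 * n)) : Prop :=
  0 < (h - r.rS).val ∧ (h - r.rS).val ≤ (r.rN - r.rS).val

/-- a pentagon from `x₄ ∈ S₄(𝔾₄)` to `y₄' ∈ S₄(𝔾₄')` (with fifth corner at a
lift of the distinguished point `a`) -/
def IsPentA {n : ℕ} (C : CommData n) (x y' : GridState n) (p : Pent n) : Prop :=
  IsRect4From x y' p.rect ∧ pr p.hh = C.h₂ ∧ onCedge C p ∧ heightOK p.rect p.hh

/-- a pentagon from `y₄' ∈ S₄(𝔾₄')` to `x₄ ∈ S₄(𝔾₄)` (fifth corner at a lift of `b`) -/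
def IsPentB {n : ℕ} (C : CommData n) (y' x : GridState n) (p : Pent n) : Prop :=
  IsRect4From y' x p.rect ∧ pr p.hh = C.h₁ ∧ onCedge C p ∧ heightOK p.rect p.hh

/-- the rows along which the boundary of the pentagon runs along `γ` rather than `β_c` -/
def detourA {n : ℕ} [NeZero n] (p : Pent n) : Finset (ZMod (2 * n)) :=
  if p.left then Finset.univ.filter (fun j => inIco p.rect.rS p.hh j)
  else Finset.univ.filter (fun j => inIco p.hh p.rect.rN j)

def detourB {n : ℕ} [NeZero n] (p : Pent n) : Finset (ZMod (2 * n)) :=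
  if p.left then Finset.univ.filter (fun j => inIco p.hh p.rect.rN j)
  else Finset.univ.filter (fun j => inIco p.rect.rS p.hh j)

/-- marking-count correction along a curved edge: in a detour row `j`, if `γ` is
west (`π₄ j ∈ J`) the bigon sliver carries the column-`(c−1)` marking, otherwise
it carries the column-`c` marking; the sliver is gained or lost according to
whether the region lies east (`east = true`) or west of the curved circle. -/
def adj {n : ℕ} [NeZero n] (C : CommData n) (f : ZMod n → ZMod n) (east : Bool)
    (D : Finset (ZMod (2 * n))) (i : ZMod n) : ℤ :=
  ∑ j ∈ D,
    if inIco C.h₁ C.h₂ (pr j) then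
      (if i = C.c - 1 ∧ f (C.c - 1) = pr j then (if east then 1 else -1) else 0)
    else
      (if i = C.c ∧ f C.c = pr j then (if east then -1 else 1) else 0)

/-- `O_i[p₄]` for a pentagon counted by `P•` -/
def pentOA {n : ℕ} [NeZero n] (C : CommData n) (p : Pent n) (i : ZMod n) : ℤ :=
  (O4count C.G p.rect i : ℤ) + adj C C.G.Orow (!p.left) (detourA p) i

def pentXA {n : ℕ} [NeZero n] (C : CommData n) (p : Pent n) (i : ZMod n) : ℤ :=
  (X4count C.G p.rect i : ℤ) + adj C C.G.Xrow (!p.left) (detourA p) i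

def pentXDisjA {n : ℕ} [NeZero n] (C : CommData n) (p : Pent n) : Prop :=
  ∀ i, pentXA C p i = 0

def pentOB {n : ℕ} [NeZero n] (C : CommData n) (p : Pent n) (i : ZMod n) : ℤ :=
  (O4count C.G p.rect i : ℤ) + adj C C.G.Orow (!p.left) (detourB p) i

def pentXB {n : ℕ} [NeZero n] (C : CommData n) (p : Pent n) (i : ZMod n) : ℤ :=
  (X4count C.G p.rect i : ℤ) + adj C C.G.Xrow (!p.left) (detourB p) i

def pentXDisjB {n : ℕ} [NeZero n] (C : CommData n) (p : Pent n) : Prop :=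
  ∀ i, pentXB C p i = 0

/-- the weight `V₁^{O₁[p₄]}⋯V_n^{O_n[p₄]} v^{m[p₄]}`, with `m[p₄] = m[I₄(p₄)]` -/
def pentWtA {n : ℕ} [NeZero n] (C : CommData n) (x y' : GridState n) (p : Pent n) : Rng n :=
  (∏ i : ZMod n, Vv i ^ (pentOA C p i).toNat) * vV ^ m4 x y' p.rect

def pentWtB {n : ℕ} [NeZero n] (C : CommData n) (y' x : GridState n) (p : Pent n) : Rng n :=
  (∏ i : ZMod n, Vv i ^ (pentOB C p i).toNat) * vV ^ m4 y' x p.rect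

/-- the pentagon-counting map `P• : GC•(𝔾₄) → GC•(𝔾₄')` -/
def Pmap {n : ℕ} [NeZero n] (C : CommData n) : GC n →ₗ[Rng n] GC n :=
  basisMap fun x => ∑ y' : GridState n,
    ∑ p ∈ Finset.univ.filter (fun p : Pent n =>
        IsPentA C x y' p ∧ normal4 p.rect ∧ pentXDisjA C p),
      Finsupp.single y' (pentWtA C x y' p)

/-- the pentagon-counting map `(P•)' : GC•(𝔾₄') → GC•(𝔾₄)` -/
def P'map {n : ℕ} [NeZero n] (C : CommData n) : GC n →ₗ[Rng n] GC n :=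
  basisMap fun y' => ∑ x : GridState n,
    ∑ p ∈ Finset.univ.filter (fun p : Pent n =>
        IsPentB C y' x p ∧ normal4 p.rect ∧ pentXDisjB C p),
      Finsupp.single x (pentWtB C y' x p)

/-- Hexagon data: the underlying rectangle `I₄(h₄)` of `𝔾₄`, the side of its
curved edge, and the lifted heights of its two crossing-point corners
(`ha` a lift of `a`, `hb` a lift of `b`). -/
structure Hex (n : ℕ) where
  rect : Rect (2 * n)
  left : Bool
  ha : ZMod (2 * n)
  hb : ZMod (2 * n)
deriving DecidableEq

instance (n : ℕ) [NeZero n] : Fintype (Hex n) :=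
  Fintype.ofEquiv (Rect (2 * n) × Bool × ZMod (2 * n) × ZMod (2 * n))
    { toFun := fun p => ⟨p.1, p.2.1, p.2.2.1, p.2.2.2⟩
      invFun := fun p => ⟨p.rect, p.left, p.ha, p.hb⟩
      left_inv := fun _ => rfl
      right_inv := fun _ => rfl }

def onCedgeH {n : ℕ} (C : CommData n) (h : Hex n) : Prop :=
  if h.left then pr h.rect.cE = C.c else pr h.rect.cW = C.c

/-- a hexagon from `x₄` to `y₄` (both states of `𝔾₄`) -/
def IsHex {n : ℕ} (C : CommData n) (x y : GridState n) (h : Hex n) : Prop :=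
  IsRect4From x y h.rect ∧ pr h.ha = C.h₂ ∧ pr h.hb = C.h₁ ∧ onCedgeH C h ∧
  heightOK h.rect h.ha ∧ heightOK h.rect h.hb

/-- the rows between the two crossing-point corners of a hexagon -/
def detourH {n : ℕ} [NeZero n] (h : Hex n) : Finset (ZMod (2 * n)) :=
  if (h.ha - h.rect.rS).val < (h.hb - h.rect.rS).val then
    Finset.univ.filter (fun j => inIco h.ha h.hb j)
  else Finset.univ.filter (fun j => inIco h.hb h.ha j)

def hexO {n : ℕ} [NeZero n] (C : CommData n) (h : Hex n) (i : ZMod n) : ℤ :=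
  (O4count C.G h.rect i : ℤ) + adj C C.G.Orow (!h.left) (detourH h) i

def hexX {n : ℕ} [NeZero n] (C : CommData n) (h : Hex n) (i : ZMod n) : ℤ :=
  (X4count C.G h.rect i : ℤ) + adj C C.G.Xrow (!h.left) (detourH h) i

def hexXDisj {n : ℕ} [NeZero n] (C : CommData n) (h : Hex n) : Prop :=
  ∀ i, hexX C h i = 0

def hexWt {n : ℕ} [NeZero n] (C : CommData n) (x y : GridState n) (h : Hex n) : Rng n :=
  (∏ i : ZMod n, Vv i ^ (hexO C h i).toNat) * vV ^ m4 x y h.rect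

/-- the hexagon-counting map `H• : GC•(𝔾₄) → GC•(𝔾₄)` -/
def Hmap {n : ℕ} [NeZero n] (C : CommData n) : GC n →ₗ[Rng n] GC n :=
  basisMap fun x => ∑ y : GridState n,
    ∑ h ∈ Finset.univ.filter (fun h : Hex n =>
        IsHex C x y h ∧ normal4 h.rect ∧ hexXDisj C h),
      Finsupp.single y (hexWt C x y h)

/-! ### Double-point enhanced grid homology -/

def cycles {n : ℕ} [NeZero n] (G : GridDiagram n) : Submodule (Rng n) (GC n) :=
  LinearMap.ker (diffB G)

def bdrIn {n : ℕ} [NeZero n] (G : GridDiagram n) : Submodule (Rng n) ↥(cycles G) :=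
  Submodule.comap (cycles G).subtype (LinearMap.range (diffB G))

instance GHquotInst {n : ℕ} [NeZero n] (G : GridDiagram n) :
    HasQuotient ↥(cycles G) (Submodule (Rng n) ↥(cycles G)) :=
  Submodule.hasQuotient (R := Rng n) (M := ↥(cycles G))

/-- the double-point enhanced grid homology `GH•(𝔾)` -/
abbrev GH {n : ℕ} [NeZero n] (G : GridDiagram n) := ↥(cycles G) ⧸ bdrIn G

/-- a homology class is homogeneous of degree `(d,s)` if it has a homogeneous
cycle representative -/
def GHhomog {n : ℕ} [NeZero n] (G : GridDiagram n) (h : GH G) (d s : ℚ) : Prop :=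
  ∃ w : ↥(cycles G), (Submodule.Quotient.mk w : GH G) = h ∧ IsHomog G (w : GC n) d s

/-! ### Commutation and stabilization moves as relations on grid diagrams -/

/-- `𝔾` and `𝔾'` differ by a column commutation move -/
def IsColComm {n : ℕ} (G G' : GridDiagram n) : Prop :=
  ∃ C : CommData n, C.G = G ∧ C.G' = G'

/-- the transposed grid diagram (exchanging the roles of rows and columns) -/
def GridDiagram.transpose {n : ℕ} (G : GridDiagram n) : GridDiagram n where
  Orow := ⇑(Equiv.ofBijective G.Orow G.hO).symm
  Xrow := ⇑(Equiv.ofBijective G.Xrow G.hX).symm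
  hO := (Equiv.ofBijective G.Orow G.hO).symm.bijective
  hX := (Equiv.ofBijective G.Xrow G.hX).symm.bijective
  hOX := by
    intro i h
    apply G.hOX ((Equiv.ofBijective G.Orow G.hO).symm i)
    have h1 : G.Orow ((Equiv.ofBijective G.Orow G.hO).symm i) = i :=
      Equiv.ofBijective_apply_symm_apply G.Orow G.hO i
    have h2 : G.Xrow ((Equiv.ofBijective G.Xrow G.hX).symm i) = i :=
      Equiv.ofBijective_apply_symm_apply G.Xrow G.hX i
    rw [h1, h, h2]

/-- `𝔾` and `𝔾'` differ by a row commutation move -/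
def IsRowComm {n : ℕ} (G G' : GridDiagram n) : Prop :=
  IsColComm G.transpose G'.transpose

/-- collapse map identifying `a` and `a+1` (used to destabilize) -/
def coll {n : ℕ} (a k : ZMod (n + 1)) : ZMod n :=
  (a.val : ZMod n) + (((k - a).val - 1 : ℕ) : ZMod n)

/-- `𝔾'` is obtained from `𝔾` by a stabilization with new 2×2 block at columns
`c', c'+1` and rows `r', r'+1`; the empty square of the block sits at the corner
selected by `(ec, er)` (east column?, north row?), and `xty` records whether the
block carries two `X`-markings (type `X:·`) or two `O`-markings (type `O:·`).
E.g. `(ec, er, xty) = (false, false, true)` is type `X:SW`, with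
`O₁ = (c'+1, r'+1)`, `X₁ = (c', r'+1)`, `X₂ = (c'+1, r')`. -/
def IsStabAt {n : ℕ} (G : GridDiagram n) (G' : GridDiagram (n + 1))
    (c' r' : ZMod (n + 1)) (ec er xty : Bool) : Prop :=
  (if xty then
    G'.Orow (if ec then c' else c' + 1) = (if er then r' else r' + 1) ∧
    G'.Xrow (if ec then c' + 1 else c') = (if er then r' else r' + 1) ∧
    G'.Xrow (if ec then c' else c' + 1) = (if er then r' + 1 else r') ∧
    G.Xrow (c'.val : ZMod n) = (r'.val : ZMod n) ∧
    G.Orow (c'.val : ZMod n) = coll r' (G'.Orow (if ec then c' + 1 else c'))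
  else
    G'.Xrow (if ec then c' else c' + 1) = (if er then r' else r' + 1) ∧
    G'.Orow (if ec then c' + 1 else c') = (if er then r' else r' + 1) ∧
    G'.Orow (if ec then c' else c' + 1) = (if er then r' + 1 else r') ∧
    G.Orow (c'.val : ZMod n) = (r'.val : ZMod n) ∧
    G.Xrow (c'.val : ZMod n) = coll r' (G'.Xrow (if ec then c' + 1 else c'))) ∧
  (∀ k : ZMod (n + 1), k ≠ c' → k ≠ c' + 1 →
    G.Orow (coll c' k) = coll r' (G'.Orow k) ∧ G.Xrow (coll c' k) = coll r' (G'.Xrow k))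

/-- `𝔾'` is obtained from `𝔾` by a stabilization move of one of the standard types -/
def IsStab {n : ℕ} (G : GridDiagram n) (G' : GridDiagram (n + 1)) : Prop :=
  ∃ c' r' ec er xty, IsStabAt G G' c' r' ec er xty

/-! ### The stabilization machinery (type `X:SW`) for the 4-fold complexes -/

/-- projection of `GC•(𝔾₄')` onto the span `I₄` of states containing the
distinguished point `c = (c'+1, r'+1)` -/
def pI {n : ℕ} (c' r' : ZMod (n + 1)) : GC (n + 1) →ₗ[Rng (n + 1)] GC (n + 1) :=
  basisMap fun x => if x (c' + 1) = r' + 1 then Finsupp.single x 1 else 0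

/-- projection onto the complementary span `N₄` -/
def pN {n : ℕ} (c' r' : ZMod (n + 1)) : GC (n + 1) →ₗ[Rng (n + 1)] GC (n + 1) :=
  basisMap fun x => if x (c' + 1) = r' + 1 then 0 else Finsupp.single x 1

/-- the submodule `I₄` -/
def Isub {n : ℕ} (c' r' : ZMod (n + 1)) : Submodule (Rng (n + 1)) (GC (n + 1)) :=
  Finsupp.supported (Rng (n + 1)) (Rng (n + 1)) {x : GridState (n + 1) | x (c' + 1) = r' + 1}

/-- the submodule `N₄` -/
def Nsub {n : ℕ} (c' r' : ZMod (n + 1)) : Submodule (Rng (n + 1)) (GC (n + 1)) :=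
  Finsupp.supported (Rng (n + 1)) (Rng (n + 1)) {x : GridState (n + 1) | x (c' + 1) ≠ r' + 1}

/-- the components `∂_{I₄}^{I₄}`, `∂_{I₄}^{N₄}`, `∂_{N₄}^{N₄}` of `∂₄•` -/
def dII {n : ℕ} [NeZero (n + 1)] (G' : GridDiagram (n + 1)) (c' r' : ZMod (n + 1)) :
    GC (n + 1) →ₗ[Rng (n + 1)] GC (n + 1) :=
  pI c' r' ∘ₗ diff4 G' ∘ₗ pI c' r'

def dIN {n : ℕ} [NeZero (n + 1)] (G' : GridDiagram (n + 1)) (c' r' : ZMod (n + 1)) :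
    GC (n + 1) →ₗ[Rng (n + 1)] GC (n + 1) :=
  pN c' r' ∘ₗ diff4 G' ∘ₗ pI c' r'

def dNN {n : ℕ} [NeZero (n + 1)] (G' : GridDiagram (n + 1)) (c' r' : ZMod (n + 1)) :
    GC (n + 1) →ₗ[Rng (n + 1)] GC (n + 1) :=
  pN c' r' ∘ₗ diff4 G' ∘ₗ pN c' r'

/-- section of the column collapse map, avoiding the new column `c'+1` -/
def sect {n : ℕ} (a : ZMod (n + 1)) (k : ZMod n) : ZMod (n + 1) :=
  a + (if k - (a.val : ZMod n) = 0 then 0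
       else (((k - (a.val : ZMod n)).val + 1 : ℕ) : ZMod (n + 1)))

def stCollFun {n : ℕ} (c' r' : ZMod (n + 1)) (x : GridState (n + 1)) :
    ZMod n → ZMod n :=
  fun k => coll r' (x (sect c' k))

/-- the destabilized grid state `x` corresponding to `x' = x ∪ {c}` -/
def stColl {n : ℕ} (c' r' : ZMod (n + 1)) (x : GridState (n + 1)) : GridState n :=
  if h : Function.Bijective (stCollFun c' r' x) then Equiv.ofBijective _ h else 1

/-- the promoted module `GC•(𝔾₄)[V₁]`: the free `𝔽[V₁,…,V_n,v]`-module on the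
grid states of the destabilized diagram -/
abbrev GCP (n : ℕ) := GridState n →₀ Rng (n + 1)

def basisMapP {n : ℕ} (f : GridState n → GCP n) : GCP n →ₗ[Rng (n + 1)] GCP n :=
  Finsupp.lsum (Rng (n + 1)) fun x => LinearMap.toSpanSingleton (Rng (n + 1)) (GCP n) (f x)

/-- the identification `e₄` (extended by zero on `N₄`) -/
def e4map {n : ℕ} (c' r' : ZMod (n + 1)) : GC (n + 1) →ₗ[Rng (n + 1)] GCP n :=
  Finsupp.lsum (Rng (n + 1)) fun x =>
    LinearMap.toSpanSingleton (Rng (n + 1)) (GCP n)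
      (if x (c' + 1) = r' + 1 then Finsupp.single (stColl c' r' x) (1 : Rng (n + 1)) else 0)

/-- renaming of the variables of the destabilized diagram into those of `𝔾'` -/
def renUp {n : ℕ} (c' : ZMod (n + 1)) : Rng n →+* Rng (n + 1) :=
  (MvPolynomial.rename (Option.map (sect c')) :
      MvPolynomial (Option (ZMod n)) F →ₐ[F] MvPolynomial (Option (ZMod (n + 1))) F).toRingHom

/-- the differential of the promoted complex `GC•(𝔾₄)[V₁]` -/
def diffP {n : ℕ} [NeZero n] (G : GridDiagram n) (c' : ZMod (n + 1)) :
    GCP n →ₗ[Rng (n + 1)] GCP n :=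
  basisMapP fun x => ∑ y : GridState n,
    ∑ r ∈ Finset.univ.filter
        (fun r : Rect (2 * n) => IsRect4From x y r ∧ normal4 r ∧ XDisjoint4 G r),
      Finsupp.single y (renUp c' (wt4 G x y r))

/-- homogeneity on the promoted complex -/
def IsHomogP {n : ℕ} [NeZero n] (G : GridDiagram n) (z : GCP n) (d s : ℚ) : Prop :=
  ∀ (y : GridState n) (k : Option (ZMod (n + 1)) →₀ ℕ), MvPolynomial.coeff k (z y) ≠ 0 →
    (MaslovO G y - 2 * ∑ i : ZMod (n + 1), (k (some i) : ℚ) + 2 * (k none : ℚ) = d) ∧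
    (Alex G y - ∑ i : ZMod (n + 1), (k (some i) : ℚ) = s)

/-- the map counting equivalence classes of rectangles crossing `X₂` (the
`X`-marking of column `c'+1`) once and no other `X`-marking -/
def HX2map {n : ℕ} (G' : GridDiagram (n + 1)) (c' : ZMod (n + 1)) :
    GC (n + 1) →ₗ[Rng (n + 1)] GC (n + 1) :=
  basisMap fun x => ∑ y : GridState (n + 1),
    ∑ r ∈ Finset.univ.filter (fun r : Rect (2 * (n + 1)) =>
        IsRect4From x y r ∧ normal4 r ∧ X4count G' r (c' + 1) = 1 ∧
        ∀ k, k ≠ c' + 1 → X4count G' r k = 0),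
      Finsupp.single y (wt4 G' x y r)

/-- its component `𝓗_{X₂}^{I₄} : N₄ → I₄` -/
def hX2I {n : ℕ} (G' : GridDiagram (n + 1)) (c' r' : ZMod (n + 1)) :
    GC (n + 1) →ₗ[Rng (n + 1)] GC (n + 1) :=
  pI c' r' ∘ₗ HX2map G' c' ∘ₗ pN c' r'

/-- weight with the variable `V_j` evaluated at `1` -/
def wtNo {n : ℕ} [NeZero n] (G : GridDiagram n) (x y : GridState n) (j : ZMod n)
    (r : Rect (2 * n)) : Rng n :=
  (∏ i ∈ Finset.univ.erase j, Vv i ^ O4count G r i) * vV ^ m4 x y r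

/-- `𝓗_{O₁}•`: counts `X`-disjoint rectangles crossing `O₁` (the `O`-marking of
column `c'+1`) once, with `V₁` evaluated at `1` -/
def HO1map {n : ℕ} (G' : GridDiagram (n + 1)) (c' : ZMod (n + 1)) :
    GC (n + 1) →ₗ[Rng (n + 1)] GC (n + 1) :=
  basisMap fun x => ∑ y : GridState (n + 1),
    ∑ r ∈ Finset.univ.filter (fun r : Rect (2 * (n + 1)) =>
        IsRect4From x y r ∧ normal4 r ∧ XDisjoint4 G' r ∧ O4count G' r (c' + 1) = 1),
      Finsupp.single y (wtNo G' x y (c' + 1) r)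

/-- its component `I₄ → N₄` -/
def hO1N {n : ℕ} (G' : GridDiagram (n + 1)) (c' r' : ZMod (n + 1)) :
    GC (n + 1) →ₗ[Rng (n + 1)] GC (n + 1) :=
  pN c' r' ∘ₗ HO1map G' c' ∘ₗ pI c' r'

/-! ### Grid diagrams of arbitrary size, and the moves of Cromwell's theorem -/

/-- a grid diagram of unspecified (positive) grid number -/
structure GDS where
  sz : ℕ+
  D : GridDiagram (sz : ℕ)

instance (p : ℕ+) : NeZero (p : ℕ) := ⟨p.ne_zero⟩

/-- a single commutation or stabilization move -/
def MoveRel (A B : GDS) : Prop :=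
  (∃ h : (A.sz : ℕ) = (B.sz : ℕ),
      IsColComm (h ▸ A.D) B.D ∨ IsRowComm (h ▸ A.D) B.D) ∨
  (∃ h : (B.sz : ℕ) = (A.sz : ℕ) + 1, IsStab A.D (h ▸ B.D))

/-- connected by a finite sequence of commutation moves and
stabilization/destabilization moves -/
def ConnectedByMoves (A B : GDS) : Prop :=
  Relation.ReflTransGen (fun X Y => MoveRel X Y ∨ MoveRel Y X) A B

/-! ### Auxiliary lemmas for the proof -/

/-- integer indicator of the cyclic interval -/
def auxInd {m : ℕ} (u v k : ZMod m) : ℤ := if inIco u v k then 1 else 0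

lemma auxInd_nonneg {m : ℕ} (u v k : ZMod m) : 0 ≤ auxInd u v k := by
  unfold auxInd; split_ifs <;> simp

lemma auxInd_step {m : ℕ} (hm : 1 < m) (u v k : ZMod m) (huv : u ≠ v) :
    auxInd u v k - auxInd u v (k - 1)
      = (if k = u then 1 else 0) - (if k = v then 1 else 0) := by
  have : NeZero m := ⟨by omega⟩
  have : Fact (1 < m) := ⟨hm⟩
  obtain ⟨t, rfl⟩ : ∃ t, k = u + t := ⟨k - u, by ring⟩
  obtain ⟨s, rfl⟩ : ∃ s, v = u + s := ⟨v - u, by ring⟩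
  have hs : s ≠ 0 := by rintro rfl; simp at huv
  have hs' : 0 < s.val := by
    rcases Nat.eq_zero_or_pos s.val with h | h
    · exact absurd ((ZMod.val_eq_zero s).1 h) hs
    · exact h
  have hsm : s.val < m := ZMod.val_lt s
  have e1 : u + t - u = t := by ring
  have e2 : u + t - 1 - u = t - 1 := by ring
  have e3 : u + s - u = s := by ring
  have e4 : (u + t = u) ↔ t = 0 := by simp
  have e5 : (u + t = u + s) ↔ t.val = s.val := by
    rw [add_right_inj]; exact (ZMod.val_injective m).eq_iff.symm
  unfold auxInd inIco
  simp only [e1, e2, e3, e4, e5]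
  by_cases ht : t = 0
  · subst ht
    have h1 : ((0 : ZMod m) - 1).val = m - 1 := by
      obtain ⟨q, rfl⟩ : ∃ q, m = q + 1 := ⟨m - 1, by omega⟩
      rw [zero_sub, ZMod.val_neg_one]; rfl
    rw [h1]
    have : ¬ (m - 1 < s.val) := by omega
    have h3 : ¬ (0 = s.val) := by omega
    simp [this, h3, hs']
  · have ht' : 0 < t.val := by
      rcases Nat.eq_zero_or_pos t.val with h | h
      · exact absurd ((ZMod.val_eq_zero t).1 h) ht
      · exact h
    have h1 : (t - 1).val = t.val - 1 := by
      rw [ZMod.val_sub (by rw [ZMod.val_one]; omega), ZMod.val_one]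
    rw [h1]
    simp only [ht, if_false]
    split_ifs <;> omega

lemma pr_add {n : ℕ} (a b : ZMod (2 * n)) : pr (a + b) = pr a + pr b := by
  simp only [pr, map_add]

lemma pr_sub {n : ℕ} (a b : ZMod (2 * n)) : pr (a - b) = pr a - pr b := by
  simp only [pr, map_sub]

lemma pr_one {n : ℕ} : pr (1 : ZMod (2 * n)) = 1 := by
  simp only [pr, map_one]

lemma pr_n {n : ℕ} : pr (n : ZMod (2 * n)) = 0 := by
  simp only [pr, map_natCast, ZMod.natCast_self]

lemma n_ne_zero4 {n : ℕ} [NeZero n] : (n : ZMod (2 * n)) ≠ 0 := by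
  intro h
  rw [ZMod.natCast_eq_zero_iff] at h
  have h1 := Nat.le_of_dvd (Nat.pos_of_ne_zero (NeZero.ne n)) h
  have := NeZero.ne n
  omega

lemma pr_eq_zero {n : ℕ} [NeZero n] (a : ZMod (2 * n)) (h : pr a = 0) :
    a = 0 ∨ a = (n : ZMod (2 * n)) := by
  have hv : ((a.val : ℕ) : ZMod n) = 0 := by
    have : pr ((a.val : ℕ) : ZMod (2 * n)) = ((a.val : ℕ) : ZMod n) := by
      simp only [pr, map_natCast]
    rw [← this, ZMod.natCast_zmod_val, h]
  rw [ZMod.natCast_eq_zero_iff] at hv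
  obtain ⟨c, hc⟩ := hv
  have hlt := ZMod.val_lt a
  have hn := Nat.pos_of_ne_zero (NeZero.ne n)
  have hc2 : c < 2 := by
    by_contra hcc
    have : n * 2 ≤ n * c := Nat.mul_le_mul_left n (by omega)
    omega
  have ha : a = ((a.val : ℕ) : ZMod (2 * n)) := (ZMod.natCast_zmod_val a).symm
  interval_cases c
  · left; rw [ha, hc]; simp
  · right; rw [ha, hc]; simp

lemma ind_pr {n : ℕ} [NeZero n] (k a : ZMod (2 * n)) :
    (if k = a then (1 : ℤ) else 0) + (if k = a + (n : ZMod (2 * n)) then 1 else 0)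
      = if pr k = pr a then 1 else 0 := by
  by_cases h : pr k = pr a
  · have h0 : pr (k - a) = 0 := by rw [pr_sub, h, sub_self]
    rcases pr_eq_zero _ h0 with h1 | h1
    · have hk : k = a := sub_eq_zero.1 h1
      subst hk
      have : ¬ (k = k + (n : ZMod (2 * n))) := by
        intro hh; exact n_ne_zero4 (left_eq_add.1 hh)
      simp [this]
    · have hk : k = a + (n : ZMod (2 * n)) := by rw [← h1]; ring
      have : ¬ (k = a) := by
        intro hh; rw [hh, sub_self] at h1; exact n_ne_zero4 h1.symm
      rw [if_neg this, if_pos hk, if_pos h]; rfl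
  · have h1 : ¬ (k = a) := by rintro rfl; exact h rfl
    have h2 : ¬ (k = a + (n : ZMod (2 * n))) := by
      rintro rfl; apply h; rw [pr_add, pr_n, add_zero]
    rw [if_neg h1, if_neg h2, if_neg h]; rfl

lemma ind_prod {α β : Type*} [DecidableEq α] [DecidableEq β] (p : α × β) (a : α) (b : β) :
    (if p = (a, b) then (1 : ℤ) else 0)
      = (if p.1 = a then 1 else 0) * (if p.2 = b then 1 else 0) := by
  obtain ⟨c, d⟩ := p
  by_cases h1 : c = a <;> by_cases h2 : d = b <;> simp [h1, h2]

/-- delta function -/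
def auxDelta {m : ℕ} (a k : ZMod m) : ℤ := if k = a then 1 else 0

lemma cornerA_eq {m : ℕ} (r : Rect m) (p : ZMod m × ZMod m) :
    cornerA r p = - ((auxDelta r.cW p.1 - auxDelta r.cE p.1) *
          (auxDelta r.rS p.2 - auxDelta r.rN p.2)) := by
  simp only [cornerA, ind_prod, auxDelta]
  ring

lemma auxDelta_pr {n : ℕ} [NeZero n] (k a : ZMod (2 * n)) :
    (if pr k = pr a then 1 else 0) = auxDelta a k + auxDelta (a + (n : ZMod (2 * n))) k :=
  (ind_pr k a).symm

lemma corner_sum {n : ℕ} [NeZero n] (r : Rect (2 * n)) (p : ZMod (2 * n) × ZMod (2 * n)) :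
    cornerA r p + cornerA (trN r) p + cornerA (trE r) p + cornerA (trN (trE r)) p
      = - (((if pr p.1 = pr r.cW then 1 else 0) - (if pr p.1 = pr r.cE then 1 else 0)) *
          ((if pr p.2 = pr r.rS then 1 else 0) - (if pr p.2 = pr r.rN then 1 else 0))) := by
  rw [auxDelta_pr, auxDelta_pr, auxDelta_pr, auxDelta_pr,
    cornerA_eq, cornerA_eq, cornerA_eq, cornerA_eq]
  simp only [trN, trE]
  ring

lemma pr_surj {n : ℕ} (i : ZMod n) : ∃ k : ZMod (2 * n), pr k = i :=
  ZMod.castHom_surjective (dvd_mul_left n 2) i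

lemma rect4_struct {n : ℕ} [NeZero n] (x y : GridState n) (r : Rect (2 * n))
    (hr : IsRect4From x y r) (hxy : x ≠ y) :
    pr r.cW ≠ pr r.cE ∧ pr r.rS ≠ pr r.rN ∧ x (pr r.cW) = pr r.rS ∧ x (pr r.cE) = pr r.rN ∧
    y (pr r.cW) = pr r.rN ∧ y (pr r.cE) = pr r.rS ∧
    ∀ i, i ≠ pr r.cW → i ≠ pr r.cE → y i = x i := by
  obtain ⟨-, -, hA, -⟩ := hr
  have key : ∀ i j : ZMod n,
      - (((if i = pr r.cW then 1 else 0) - (if i = pr r.cE then 1 else 0)) *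
          ((if j = pr r.rS then 1 else 0) - (if j = pr r.rN then (1 : ℤ) else 0)))
        = (if y i = j then 1 else 0) - (if x i = j then 1 else 0) := by
    intro i j
    obtain ⟨k, rfl⟩ := pr_surj i
    obtain ⟨l, rfl⟩ := pr_surj j
    have := hA (k, l)
    rw [corner_sum] at this
    exact this
  have hyx : ∀ i, (∀ j, (if y i = j then 1 else 0) - (if x i = j then (1 : ℤ) else 0) = 0) →
      y i = x i := by
    intro i h
    have := h (x i)
    by_contra hne
    rw [if_neg hne] at this
    simp at this
  have hc : pr r.cW ≠ pr r.cE := by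
    intro h
    apply hxy
    refine Equiv.ext fun i => (hyx i fun j => ?_).symm
    rw [← key, h]; ring
  have hs : pr r.rS ≠ pr r.rN := by
    intro h
    apply hxy
    refine Equiv.ext fun i => (hyx i fun j => ?_).symm
    rw [← key, h]; ring
  refine ⟨hc, hs, ?_, ?_, ?_, ?_, ?_⟩
  · have := key (pr r.cW) (pr r.rS)
    by_contra hne
    simp only [hc, hs, hne, if_true, if_false] at this
    split_ifs at this <;> norm_num at this
  · have := key (pr r.cE) (pr r.rN)
    by_contra hne
    simp only [hc.symm, hs.symm, hne, if_true, if_false] at this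
    split_ifs at this <;> norm_num at this
  · have := key (pr r.cW) (pr r.rN)
    by_contra hne
    simp only [hc, hs.symm, hne, if_true, if_false] at this
    split_ifs at this <;> norm_num at this
  · have := key (pr r.cE) (pr r.rS)
    by_contra hne
    simp only [hc.symm, hs, hne, if_true, if_false] at this
    split_ifs at this <;> norm_num at this
  · intro i h1 h2
    apply hyx
    intro j
    rw [← key, if_neg h1, if_neg h2]; ring

/-- number of lifts of the square-column `i` lying in the interval -/
def auxF {n : ℕ} [NeZero n] (u v : ZMod (2 * n)) (i : ZMod n) : ℤ :=
  ∑ k : ZMod (2 * n), if pr k = i then auxInd u v k else 0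

/-- boundary-weighted count -/
def auxU {n : ℕ} [NeZero n] (u v : ZMod (2 * n)) (i : ZMod n) : ℤ :=
  ∑ k : ZMod (2 * n), if pr k = i then auxInd u v k + auxInd u v (k - 1) else 0

lemma auxF_nonneg {n : ℕ} [NeZero n] (u v : ZMod (2 * n)) (i : ZMod n) : 0 ≤ auxF u v i := by
  apply Finset.sum_nonneg
  intro k _
  split_ifs
  · exact auxInd_nonneg u v k
  · exact le_rfl

lemma auxF_pred {n : ℕ} [NeZero n] (u v : ZMod (2 * n)) (i : ZMod n) :
    auxF u v (i - 1) = ∑ k : ZMod (2 * n), if pr k = i then auxInd u v (k - 1) else 0 := by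
  unfold auxF
  rw [← Equiv.sum_comp (Equiv.subRight (1 : ZMod (2 * n)))]
  apply Finset.sum_congr rfl
  intro k _
  simp only [Equiv.subRight_apply, pr_sub, pr_one, sub_left_inj]

lemma auxU_eq {n : ℕ} [NeZero n] (u v : ZMod (2 * n)) (i : ZMod n) :
    auxU u v i = auxF u v i + auxF u v (i - 1) := by
  rw [auxF_pred]
  unfold auxF auxU
  rw [← Finset.sum_add_distrib]
  apply Finset.sum_congr rfl
  intro k _
  split_ifs <;> simp

lemma auxF_step {n : ℕ} [NeZero n] (u v : ZMod (2 * n)) (huv : u ≠ v) (i : ZMod n) :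
    auxF u v i - auxF u v (i - 1)
      = (if i = pr u then 1 else 0) - (if i = pr v then 1 else 0) := by
  have hm : 1 < 2 * n := by have := NeZero.ne n; omega
  rw [auxF_pred]
  unfold auxF
  rw [← Finset.sum_sub_distrib]
  have : ∀ k : ZMod (2 * n), ((if pr k = i then auxInd u v k else 0)
      - (if pr k = i then auxInd u v (k - 1) else 0))
      = (if k = u then (if i = pr u then 1 else 0) else 0)
        - (if k = v then (if i = pr v then 1 else 0) else 0) := by
    intro k
    have hs := auxInd_step hm u v k huv
    by_cases hk : pr k = i
    · subst hk
      rw [if_pos rfl, if_pos rfl, hs]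
      by_cases h1 : k = u <;> by_cases h2 : k = v <;> grind
    · rw [if_neg hk, if_neg hk]
      by_cases h1 : k = u <;> by_cases h2 : k = v <;> grind
  rw [Finset.sum_congr rfl (fun k _ => this k), Finset.sum_sub_distrib]
  simp

lemma auxF_walk {n : ℕ} [NeZero n] (u v : ZMod (2 * n)) (huv : pr u ≠ pr v) :
    auxF u v (pr v) = auxF u v (pr u - 1) := by
  have huv' : u ≠ v := fun h => huv (by rw [h])
  have hd : 0 < (pr u - pr v).val := by
    rcases Nat.eq_zero_or_pos (pr u - pr v).val with h | h
    · exact absurd (sub_eq_zero.1 ((ZMod.val_eq_zero _).1 h)) huv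
    · exact h
  have hlt := ZMod.val_lt (pr u - pr v)
  have walk : ∀ j : ℕ, j < (pr u - pr v).val →
      auxF u v (pr v + (j : ZMod n)) = auxF u v (pr v) := by
    intro j
    induction j with
    | zero => intro _; simp
    | succ j ih =>
      intro hj
      have hs := auxF_step u v huv' (pr v + ((j + 1 : ℕ) : ZMod n))
      have e : pr v + ((j + 1 : ℕ) : ZMod n) - 1 = pr v + (j : ZMod n) := by push_cast; ring
      rw [e, ih (by omega)] at hs
      have h1 : ¬ (pr v + ((j + 1 : ℕ) : ZMod n) = pr u) := by
        intro h
        have h2 : pr u - pr v = ((j + 1 : ℕ) : ZMod n) := by rw [← h]; ring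
        have h3 := congrArg ZMod.val h2
        rw [ZMod.val_natCast_of_lt (by omega)] at h3
        omega
      have h2 : ¬ (pr v + ((j + 1 : ℕ) : ZMod n) = pr v) := by
        intro h
        have h2 : ((j + 1 : ℕ) : ZMod n) = 0 := by simpa using h
        have h3 := congrArg ZMod.val h2
        rw [ZMod.val_natCast_of_lt (by omega), ZMod.val_zero] at h3
        omega
      rw [if_neg h1, if_neg h2] at hs
      linarith
  have := walk ((pr u - pr v).val - 1) (by omega)
  rw [← this]
  congr 1
  rw [Nat.cast_sub (by omega), ZMod.natCast_zmod_val]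
  push_cast
  ring

/-- structure of the weighted count: even away from the end circles, and the same odd number
at both end circles -/
lemma auxU_struct {n : ℕ} [NeZero n] (u v : ZMod (2 * n)) (huv : pr u ≠ pr v) :
    ∃ e : ℕ, auxU u v (pr u) = 2 * e + 1 ∧ auxU u v (pr v) = 2 * e + 1 ∧
      ∀ i, i ≠ pr u → i ≠ pr v → auxU u v i = 2 * auxF u v i := by
  have huv' : u ≠ v := fun h => huv (by rw [h])
  have hw := auxF_walk u v huv
  refine ⟨(auxF u v (pr v)).toNat, ?_, ?_, ?_⟩
  · have hs := auxF_step u v huv' (pr u)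
    rw [if_pos rfl, if_neg huv] at hs
    rw [auxU_eq, Int.toNat_of_nonneg (auxF_nonneg _ _ _)]
    linarith
  · have hs := auxF_step u v huv' (pr v)
    rw [if_pos rfl, if_neg huv.symm] at hs
    rw [auxU_eq, Int.toNat_of_nonneg (auxF_nonneg _ _ _)]
    linarith
  · intro i h1 h2
    have hs := auxF_step u v huv' i
    rw [if_neg h1, if_neg h2] at hs
    rw [auxU_eq]
    linarith

lemma mult_eq {m : ℕ} (r : Rect m) (a b : ZMod m) :
    (r.mult (a, b) : ℤ) = auxInd r.cW r.cE a * auxInd r.rS r.rN b := by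
  unfold Rect.mult auxInd
  by_cases h1 : inIco r.cW r.cE a <;> by_cases h2 : inIco r.rS r.rN b <;> simp [h1, h2]

lemma rpm4_eq {n : ℕ} [NeZero n] (w : GridState n) (r : Rect (2 * n)) :
    rpm4 w r
      = ((∑ i : ZMod n, auxU r.cW r.cE i * auxU r.rS r.rN (w i) : ℤ) : ℚ) / 4 := by
  unfold rpm4 pm4
  congr 1
  have hR : (∑ i : ZMod n, auxU r.cW r.cE i * auxU r.rS r.rN (w i))
      = ∑ k : ZMod (2 * n), (auxInd r.cW r.cE k + auxInd r.cW r.cE (k - 1))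
          * auxU r.rS r.rN (w (pr k)) := by
    unfold auxU
    simp_rw [Finset.sum_mul]
    rw [Finset.sum_comm]
    apply Finset.sum_congr rfl
    intro k _
    rw [Finset.sum_eq_single (pr k)]
    · rw [if_pos rfl]
    · intro b _ hb
      rw [if_neg hb.symm, zero_mul]
    · intro h; exact absurd (Finset.mem_univ _) h
  rw [hR, Fintype.sum_prod_type]
  push_cast
  apply Finset.sum_congr rfl
  intro k _
  unfold auxU
  push_cast
  rw [Finset.mul_sum]
  apply Finset.sum_congr rfl
  intro l _
  by_cases h : w (pr k) = pr l
  · have h' : pr l = w (pr k) := h.symm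
    rw [if_pos h, if_pos h']
    simp only [Rect.dom4, mult_eq]
    push_cast
    ring
  · have h' : ¬ (pr l = w (pr k)) := fun hh => h hh.symm
    rw [if_neg h, if_neg h', mul_zero]

/-- Lemma on `m[r₄]`.  If `x₄ ≠ y₄` are grid states of `𝔾₄` and
`[r₄] ∈ [Rect](x₄, y₄)`, then `p_{x₄}[r₄] + p_{y₄}[r₄]` is a positive odd integer;
consequently `m[r₄] = (p_{x₄}[r₄] + p_{y₄}[r₄] − 1)/2` is a nonnegative integer. -/
theorem statement0 (n : ℕ) [NeZero n] (x y : GridState n) (r : Rect (2 * n))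
    (hr : IsRect4From x y r) (hxy : x ≠ y) :
    ∃ k : ℕ, rpm4 x r + rpm4 y r = 2 * (k : ℚ) + 1 ∧ mQ4 x y r = (k : ℚ) := by
  obtain ⟨hc, hs, hxW, hxE, hyW, hyE, hag⟩ := rect4_struct x y r hr hxy
  obtain ⟨e, hU1, hU2, hU⟩ := auxU_struct r.cW r.cE hc
  obtain ⟨f, hV1, hV2, hV⟩ := auxU_struct r.rS r.rN hs
  have hsum : (∑ i : ZMod n, auxU r.cW r.cE i * auxU r.rS r.rN (x i))
      + (∑ i : ZMod n, auxU r.cW r.cE i * auxU r.rS r.rN (y i))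
      = 8 * (∑ i ∈ (Finset.univ.erase (pr r.cW)).erase (pr r.cE),
          auxF r.cW r.cE i * auxF r.rS r.rN (x i))
        + 4 * ((2 * e + 1) * (2 * f + 1)) := by
    have hmem : pr r.cE ∈ Finset.univ.erase (pr r.cW) :=
      Finset.mem_erase.2 ⟨hc.symm, Finset.mem_univ _⟩
    rw [← Finset.sum_add_distrib, ← Finset.add_sum_erase _ _ (Finset.mem_univ (pr r.cW)),
      ← Finset.add_sum_erase _ _ hmem, hxW, hxE, hyW, hyE, hU1, hU2, hV1, hV2,
      Finset.mul_sum]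
    have : ∀ i ∈ (Finset.univ.erase (pr r.cW)).erase (pr r.cE),
        auxU r.cW r.cE i * auxU r.rS r.rN (x i) + auxU r.cW r.cE i * auxU r.rS r.rN (y i)
          = 8 * (auxF r.cW r.cE i * auxF r.rS r.rN (x i)) := by
      intro i hi
      rw [Finset.mem_erase, Finset.mem_erase] at hi
      obtain ⟨hiE, hiW, -⟩ := hi
      have h1 : x i ≠ pr r.rS := by
        rw [← hxW]; exact fun h => hiW (x.injective h)
      have h2 : x i ≠ pr r.rN := by
        rw [← hxE]; exact fun h => hiE (x.injective h)
      rw [hag i hiW hiE, hU i hiW hiE, hV _ h1 h2]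
      ring
    rw [Finset.sum_congr rfl this]
    ring
  have hT : 0 ≤ ∑ i ∈ (Finset.univ.erase (pr r.cW)).erase (pr r.cE),
          auxF r.cW r.cE i * auxF r.rS r.rN (x i) :=
    Finset.sum_nonneg fun i _ => mul_nonneg (auxF_nonneg _ _ _) (auxF_nonneg _ _ _)
  obtain ⟨T, hTe⟩ := Int.eq_ofNat_of_zero_le hT
  rw [hTe] at hsum
  have hsumQ := congrArg (fun z : ℤ => (z : ℚ)) hsum
  simp only [Int.cast_add, Int.cast_mul, Int.cast_natCast, Int.cast_ofNat, Int.cast_one] at hsumQ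
  have hmain : rpm4 x r + rpm4 y r = 2 * ((T + 2 * e * f + e + f : ℕ) : ℚ) + 1 := by
    rw [rpm4_eq, rpm4_eq]
    push_cast
    push_cast at hsumQ
    linarith
  refine ⟨T + 2 * e * f + e + f, hmain, ?_⟩
  unfold mQ4
  rw [hmain]
  ring

end GridHomology
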